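/- Let H be an ℝ^d-valued Gaussian random vector with mean μ_H and symmetric positive definite covariance Σ_H, let M be an invertible d×d real matrix, V ∈ ℝ^d, and S := M H + V. Let J ≥ 1 and for j = 1,…,J let γ_j > 0, ω_j > 0 with ω_1 + … + ω_J = 1, α_j := ω_j/γ_j, and γ := (α_1 + … + α_J)⁻¹. For each j let M̄^j be a symmetric d×d matrix with Σ_H⁻¹ + M̄^j positive definite, V̄^j ∈ ℝ^d, λ̄^j ∈ ℝ, and ℰ^j := (1/γ_j)((1/2) Hᵀ M̄^j H + Hᵀ V̄^j + λ̄^j). Let Ψ ∈ ℝ^d, set M̄ := γ Σ_j α_j M̄^j and V̄ := -γ( Σ_j α_j V̄^j + Mᵀ Ψ ), and define the equilibrium price p := V + M (I_d + Σ_H M̄)⁻¹ (μ_H + Σ_H V̄). Then, with π̂^j denoting the unique minimizer over ℝ^d of π ↦ E[exp(-γ_j (πᵀ(S - p) + ℰ^j))], the market clears: Σ_{j=1}^J ω_j π̂^j = Ψ. -/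

import Mathlib

open MeasureTheory ProbabilityTheory Matrix Filter

/-- The density of a `N(μ, S)` Gaussian on `ℝ^d` (with respect to Lebesgue measure). -/
noncomputable def gaussianPdf (d : ℕ) (μ : Fin d → ℝ) (S : Matrix (Fin d) (Fin d) ℝ)
    (x : Fin d → ℝ) : ℝ :=
  (Real.sqrt ((2 * Real.pi) ^ d * S.det))⁻¹ *
    Real.exp (-(1 / 2) * ((x - μ) ⬝ᵥ (S⁻¹ *ᵥ (x - μ))))

/-- `X` is a Gaussian random vector with mean `μ` and covariance matrix `S`. -/
def IsGaussianVec {Ω : Type*} [MeasurableSpace Ω] (P : Measure Ω) {d : ℕ}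
    (X : Ω → Fin d → ℝ) (μ : Fin d → ℝ) (S : Matrix (Fin d) (Fin d) ℝ) : Prop :=
  Measure.map X P = volume.withDensity fun x => ENNReal.ofReal (gaussianPdf d μ S x)

/-- The exponential disutility `exp(-γ(πᵀ(S - p) + ℰ))` of position `π` at price `p` for a
CARA agent with risk aversion `γ` and endowment `ℰ = (1/γ)((1/2)HᵀM̄H + HᵀV̄ + λ̄)`, where the
asset payoff is `S = MH + V`. -/
noncomputable def expDisutility {Ω : Type*} {d : ℕ} (H : Ω → Fin d → ℝ)
    (M : Matrix (Fin d) (Fin d) ℝ) (V : Fin d → ℝ) (γ : ℝ)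
    (Mb : Matrix (Fin d) (Fin d) ℝ) (Vb : Fin d → ℝ) (lb : ℝ)
    (p π : Fin d → ℝ) (ω : Ω) : ℝ :=
  Real.exp (-γ * (π ⬝ᵥ ((M *ᵥ H ω + V) - p) +
    (1 / γ) * ((1 / 2) * (H ω ⬝ᵥ (Mb *ᵥ H ω)) + H ω ⬝ᵥ Vb + lb)))

theorem dotProduct_mulVec_comm_of_isSymm {n : Type*} [Fintype n] {A : Matrix n n ℝ}
    (hA : A.IsSymm) (x y : n → ℝ) : x ⬝ᵥ (A *ᵥ y) = y ⬝ᵥ (A *ᵥ x) := by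
  rw [dotProduct_mulVec, ← mulVec_transpose, hA.eq, dotProduct_comm]

theorem gaussian_exponent_eq_complete_square {n : Type*} [Fintype n] {B C : Matrix n n ℝ}
    (hB : B.IsSymm) (hC : C.IsSymm) (μ b v m w x : n → ℝ) (l : ℝ)
    (hv : v = B *ᵥ μ - b - (B + C) *ᵥ w) :
    -(1 / 2) * ((x - μ) ⬝ᵥ (B *ᵥ (x - μ))) +
        -(v ⬝ᵥ (x - m) + ((1 / 2) * (x ⬝ᵥ (C *ᵥ x)) + x ⬝ᵥ b + l)) =
      ((1 / 2) * (m ⬝ᵥ ((B + C) *ᵥ m)) - (1 / 2) * (μ ⬝ᵥ (B *ᵥ μ)) + m ⬝ᵥ (B *ᵥ μ - b)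
        - m ⬝ᵥ ((B + C) *ᵥ m) - l) +
      (1 / 2) * ((w - m) ⬝ᵥ ((B + C) *ᵥ (w - m))) +
        -(1 / 2) * ((x - w) ⬝ᵥ ((B + C) *ᵥ (x - w))) := by
  subst hv
  rw [dotProduct_comm _ (x - m)]
  simp only [add_mulVec, mulVec_sub, sub_dotProduct, dotProduct_sub, dotProduct_add]
  rw [dotProduct_mulVec_comm_of_isSymm hB μ x, dotProduct_mulVec_comm_of_isSymm hB w x,
    dotProduct_mulVec_comm_of_isSymm hC w x, dotProduct_mulVec_comm_of_isSymm hB w m,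
    dotProduct_mulVec_comm_of_isSymm hC w m]
  ring

theorem IsGaussianVec.integral_comp {Ω : Type*} [MeasurableSpace Ω] {P : Measure Ω} {d : ℕ}
    {X : Ω → Fin d → ℝ} {μ : Fin d → ℝ} {S : Matrix (Fin d) (Fin d) ℝ}
    (h : IsGaussianVec P X μ S) (hX : Measurable X) {g : (Fin d → ℝ) → ℝ} (hg : Continuous g) :
    ∫ ω, g (X ω) ∂P = ∫ x, gaussianPdf d μ S x * g x := by
  have hcont : Continuous (gaussianPdf d μ S) := by
    unfold gaussianPdf
    fun_prop
  rw [← integral_map hX.aemeasurable hg.aestronglyMeasurable, h,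
    integral_withDensity_eq_integral_toReal_smul (by fun_prop) (by simp)]
  refine integral_congr_ae (.of_forall fun x => ?_)
  have : 0 ≤ gaussianPdf d μ S x := by unfold gaussianPdf; positivity
  simp [ENNReal.toReal_ofReal this]

/-- The expected disutility at the price `V + M m` depends on the position only through the
quadratic form of the vector `w` solving `γ Mᵀ π = Σ_H⁻¹ μ_H - V̄ - (Σ_H⁻¹ + M̄) w`. -/
theorem integral_expDisutility {Ω : Type*} [MeasurableSpace Ω] {P : Measure Ω} {d : ℕ}
    {H : Ω → Fin d → ℝ} (hH : Measurable H) {μH : Fin d → ℝ} {SH : Matrix (Fin d) (Fin d) ℝ}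
    (hSH : SH.IsSymm) (hGauss : IsGaussianVec P H μH SH) (M : Matrix (Fin d) (Fin d) ℝ)
    (V : Fin d → ℝ) {γ : ℝ} (hγ : γ ≠ 0) {Mb : Matrix (Fin d) (Fin d) ℝ} (hMb : Mb.IsSymm)
    (Vb : Fin d → ℝ) (lb : ℝ) (m w π : Fin d → ℝ)
    (hπ : γ • (Mᵀ *ᵥ π) = SH⁻¹ *ᵥ μH - Vb - (SH⁻¹ + Mb) *ᵥ w) :
    ∫ ω, expDisutility H M V γ Mb Vb lb (V + M *ᵥ m) π ω ∂P =
      ((Real.sqrt ((2 * Real.pi) ^ d * SH.det))⁻¹ *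
        Real.exp ((1 / 2) * (m ⬝ᵥ ((SH⁻¹ + Mb) *ᵥ m)) - (1 / 2) * (μH ⬝ᵥ (SH⁻¹ *ᵥ μH)) +
          m ⬝ᵥ (SH⁻¹ *ᵥ μH - Vb) - m ⬝ᵥ ((SH⁻¹ + Mb) *ᵥ m) - lb) *
        ∫ x : Fin d → ℝ, Real.exp (-(1 / 2) * (x ⬝ᵥ ((SH⁻¹ + Mb) *ᵥ x)))) *
      Real.exp ((1 / 2) * ((w - m) ⬝ᵥ ((SH⁻¹ + Mb) *ᵥ (w - m)))) := by
  have hSi : SH⁻¹.IsSymm := by rw [Matrix.IsSymm, transpose_nonsing_inv, hSH.eq]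
  unfold expDisutility
  rw [hGauss.integral_comp hH (g := fun x => Real.exp (-γ * (π ⬝ᵥ ((M *ᵥ x + V) - (V + M *ᵥ m)) +
    (1 / γ) * ((1 / 2) * (x ⬝ᵥ (Mb *ᵥ x)) + x ⬝ᵥ Vb + lb)))) (by fun_prop),
    ← integral_sub_right_eq_self
      (fun x : Fin d → ℝ => Real.exp (-(1 / 2) * (x ⬝ᵥ ((SH⁻¹ + Mb) *ᵥ x)))) w,
    ← integral_const_mul, ← integral_mul_const]
  refine integral_congr_ae (.of_forall fun x => ?_)
  have key := gaussian_exponent_eq_complete_square hSi hMb μH Vb _ m w x lb hπ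
  have hlin : -γ * (π ⬝ᵥ ((M *ᵥ x + V) - (V + M *ᵥ m)) +
      (1 / γ) * ((1 / 2) * (x ⬝ᵥ (Mb *ᵥ x)) + x ⬝ᵥ Vb + lb)) =
      -((γ • (Mᵀ *ᵥ π)) ⬝ᵥ (x - m) + ((1 / 2) * (x ⬝ᵥ (Mb *ᵥ x)) + x ⬝ᵥ Vb + lb)) := by
    have h1 : (M *ᵥ x + V) - (V + M *ᵥ m) = M *ᵥ (x - m) := by rw [mulVec_sub]; abel
    rw [h1, dotProduct_mulVec, ← mulVec_transpose, smul_dotProduct, smul_eq_mul]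
    field_simp
  simp only [gaussianPdf]
  rw [hlin, mul_assoc, ← Real.exp_add, key, Real.exp_add, Real.exp_add]
  ring

/-- First-order condition for the optimal position at the price `V + M m`. -/
theorem optimal_position_eq {Ω : Type*} [MeasurableSpace Ω] {P : Measure Ω} {d : ℕ}
    {H : Ω → Fin d → ℝ} (hH : Measurable H) {μH : Fin d → ℝ} {SH : Matrix (Fin d) (Fin d) ℝ}
    (hSH : SH.IsSymm) (hGauss : IsGaussianVec P H μH SH) {M : Matrix (Fin d) (Fin d) ℝ}
    (hM : IsUnit M.det) (V : Fin d → ℝ) {γ : ℝ} (hγ : γ ≠ 0) {Mb : Matrix (Fin d) (Fin d) ℝ}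
    (hMb : Mb.IsSymm) (hpd : (SH⁻¹ + Mb).PosDef) (Vb : Fin d → ℝ) (lb : ℝ) (m πhat : Fin d → ℝ)
    (hopt : ∀ π : Fin d → ℝ, π ≠ πhat →
      ∫ ω, expDisutility H M V γ Mb Vb lb (V + M *ᵥ m) πhat ω ∂P <
        ∫ ω, expDisutility H M V γ Mb Vb lb (V + M *ᵥ m) π ω ∂P) :
    γ • (Mᵀ *ᵥ πhat) = SH⁻¹ *ᵥ μH - Vb - (SH⁻¹ + Mb) *ᵥ m := by
  have hA : IsUnit (SH⁻¹ + Mb).det := hpd.det_pos.ne'.isUnit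
  have hMt : IsUnit Mᵀ.det := by rwa [det_transpose]
  set c := SH⁻¹ *ᵥ μH - Vb with hc
  have hπ : γ • (Mᵀ *ᵥ (γ⁻¹ • (Mᵀ⁻¹ *ᵥ (c - (SH⁻¹ + Mb) *ᵥ m)))) = c - (SH⁻¹ + Mb) *ᵥ m := by
    rw [mulVec_smul, smul_smul, mul_inv_cancel₀ hγ, one_smul, mulVec_mulVec,
      mul_nonsing_inv _ hMt, one_mulVec]
  by_contra hne
  have hlt := hopt (γ⁻¹ • (Mᵀ⁻¹ *ᵥ (c - (SH⁻¹ + Mb) *ᵥ m))) (fun h => hne (h ▸ hπ))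
  rw [integral_expDisutility hH hSH hGauss M V hγ hMb Vb lb m m _ hπ,
    integral_expDisutility hH hSH hGauss M V hγ hMb Vb lb m
      ((SH⁻¹ + Mb)⁻¹ *ᵥ (c - γ • (Mᵀ *ᵥ πhat))) πhat (by
        rw [mulVec_mulVec, mul_nonsing_inv _ hA, one_mulVec, ← hc, sub_sub_cancel])] at hlt
  have hlt' := lt_of_mul_lt_mul_left hlt (by
    refine mul_nonneg (by positivity) (integral_nonneg fun x => (Real.exp_pos _).le))
  rw [Real.exp_lt_exp, sub_self, zero_dotProduct] at hlt'
  have := hpd.posSemidef.dotProduct_mulVec_nonneg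
    ((SH⁻¹ + Mb)⁻¹ *ᵥ (c - γ • (Mᵀ *ᵥ πhat)) - m)
  simp only [star_trivial] at this
  linarith

/-- Single-period CARA–Gaussian equilibrium: at the price
`p = V + M(I + Σ_H M̄)⁻¹(μ_H + Σ_H V̄)` the individually optimal demands clear the market,
`Σ_j ω_j π̂^j = Ψ`. -/
theorem stmt_4 {Ω : Type*} [MeasurableSpace Ω] (P : Measure Ω) [IsProbabilityMeasure P]
    (d : ℕ) (H : Ω → Fin d → ℝ) (hH : Measurable H)
    (μH : Fin d → ℝ) (SH : Matrix (Fin d) (Fin d) ℝ) (hSH : SH.PosDef)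
    (hGauss : IsGaussianVec P H μH SH)
    (M : Matrix (Fin d) (Fin d) ℝ) (hM : IsUnit M.det) (V : Fin d → ℝ)
    (J : ℕ) (hJ : 1 ≤ J)
    (γs ωs : Fin J → ℝ) (hγs : ∀ j, 0 < γs j) (hωs : ∀ j, 0 < ωs j)
    (hωsum : ∑ j, ωs j = 1)
    (αs : Fin J → ℝ) (hαs : ∀ j, αs j = ωs j / γs j)
    (γr : ℝ) (hγr : γr = (∑ j, αs j)⁻¹)
    (Mbs : Fin J → Matrix (Fin d) (Fin d) ℝ) (hMbsymm : ∀ j, (Mbs j).IsSymm)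
    (hMbpd : ∀ j, (SH⁻¹ + Mbs j).PosDef)
    (Vbs : Fin J → Fin d → ℝ) (lbs : Fin J → ℝ)
    (Ψ : Fin d → ℝ)
    (Mbar : Matrix (Fin d) (Fin d) ℝ) (hMbar : Mbar = γr • ∑ j, αs j • Mbs j)
    (Vbar : Fin d → ℝ) (hVbar : Vbar = -γr • (∑ j, αs j • Vbs j + Mᵀ *ᵥ Ψ))
    (p : Fin d → ℝ) (hp : p = V + M *ᵥ ((1 + SH * Mbar)⁻¹ *ᵥ (μH + SH *ᵥ Vbar)))
    (πhat : Fin J → Fin d → ℝ)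
    (hopt : ∀ j, ∀ π : Fin d → ℝ, π ≠ πhat j →
      ∫ ω, expDisutility H M V (γs j) (Mbs j) (Vbs j) (lbs j) p (πhat j) ω ∂P <
        ∫ ω, expDisutility H M V (γs j) (Mbs j) (Vbs j) (lbs j) p π ω ∂P) :
    ∑ j, ωs j • πhat j = Ψ := by
  have hSHsymm : SH.IsSymm := by simpa using hSH.isHermitian
  have hSHdet : IsUnit SH.det := hSH.det_pos.ne'.isUnit
  have hα : ∀ j, 0 < αs j := fun j => hαs j ▸ div_pos (hωs j) (hγs j)
  have hne : (Finset.univ : Finset (Fin J)).Nonempty := ⟨⟨0, hJ⟩, Finset.mem_univ _⟩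
  have hsum : 0 < ∑ j, αs j := Finset.sum_pos (fun j _ => hα j) hne
  have hγpos : 0 < γr := hγr ▸ inv_pos.2 hsum
  have hγsum : γr * ∑ j, αs j = 1 := by rw [hγr, inv_mul_cancel₀ hsum.ne']
  have hagg : SH⁻¹ + Mbar = γr • ∑ j, αs j • (SH⁻¹ + Mbs j) := by
    simp only [smul_add, Finset.sum_add_distrib]
    rw [← Finset.sum_smul, smul_smul, hγsum, one_smul, hMbar]
  have hpd : (SH⁻¹ + Mbar).PosDef := by
    rw [hagg]
    exact (posDef_sum hne fun j _ => (hMbpd j).smul (hα j)).smul hγpos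
  have hfac : 1 + SH * Mbar = SH * (SH⁻¹ + Mbar) := by
    rw [mul_add, mul_nonsing_inv _ hSHdet]
  have hdet : IsUnit (1 + SH * Mbar).det := by
    rw [hfac, det_mul]
    exact hSHdet.mul hpd.det_pos.ne'.isUnit
  set m := (1 + SH * Mbar)⁻¹ *ᵥ (μH + SH *ᵥ Vbar) with hm
  have hmeq : (SH⁻¹ + Mbar) *ᵥ m = SH⁻¹ *ᵥ μH + Vbar := by
    have h : (1 + SH * Mbar) *ᵥ m = μH + SH *ᵥ Vbar := by
      rw [hm, mulVec_mulVec, mul_nonsing_inv _ hdet, one_mulVec]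
    have h' := congrArg (SH⁻¹ *ᵥ ·) h
    simpa only [hfac, mulVec_mulVec, mulVec_add, ← mul_assoc, nonsing_inv_mul _ hSHdet,
      one_mul, one_mulVec] using h'
  subst hp
  have hfoc j := optimal_position_eq hH hSHsymm hGauss hM V (hγs j).ne' (hMbsymm j) (hMbpd j)
    (Vbs j) (lbs j) m (πhat j) (hopt j)
  have hdemand : γr • (Mᵀ *ᵥ ∑ j, ωs j • πhat j) = γr • (Mᵀ *ᵥ Ψ) := by
    calc γr • (Mᵀ *ᵥ ∑ j, ωs j • πhat j)
        = γr • ∑ j, αs j • (γs j • (Mᵀ *ᵥ πhat j)) := by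
          simp only [mulVec_sum, mulVec_smul, smul_smul, hαs, div_mul_cancel₀ _ (hγs _).ne']
      _ = SH⁻¹ *ᵥ μH - γr • (∑ j, αs j • Vbs j) - (SH⁻¹ + Mbar) *ᵥ m := by
          simp only [hfoc, smul_sub, Finset.sum_sub_distrib]
          rw [← Finset.sum_smul, smul_smul, hγsum, one_smul, hagg, smul_mulVec, sum_mulVec]
          simp only [smul_mulVec]
      _ = γr • (Mᵀ *ᵥ Ψ) := by
          rw [hmeq, hVbar, neg_smul, smul_add]
          abel
  have hMt : IsUnit Mᵀ := (isUnit_iff_isUnit_det _).2 (by rwa [det_transpose])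
  exact mulVec_injective_of_isUnit hMt (smul_right_injective _ hγpos.ne' hdemand)
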